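/- arXiv:2504.07259 — 2 statements merged into one kernel-verified Lean document; each statement's English description precedes it below -/
import Mathlib

section
/- Let H be a real Hilbert space and let f, g : H → ℝ be convex functions of class C² (twice continuously differentiable). Assume (i) ‖∇f(x)‖ = ‖∇g(x)‖ for all x ∈ H, and (ii) p_f = p_g, where p_f (resp. p_g) is the Crandall–Pazy direction of f (resp. g). Then there exists a constant c ∈ ℝ such that f(x) = g(x) + c for all x ∈ H. -/
open Set Filter
open Topology
open scoped RealInnerProductSpace

/-- A weak form of Ekeland's variational principle: a continuous function that is bounded below
on a complete metric space admits approximate minimizers `y` at which it cannot decrease at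
rate larger than `c`. -/
theorem exists_forall_le_add_mul_dist {X : Type*} [MetricSpace X] [CompleteSpace X]
    {θ : X → ℝ} (hθ : Continuous θ) {B : ℝ} (hB : ∀ x, B ≤ θ x) {c : ℝ} (hc : 0 < c) (x₀ : X) :
    ∃ y, θ y ≤ θ x₀ ∧ ∀ z, θ y ≤ θ z + c * dist y z := by
  have hstep : ∀ (n : ℕ) (x : X), ∃ y, θ y + c * dist x y ≤ θ x ∧
      ∀ z, θ z + c * dist x z ≤ θ x → θ y ≤ θ z + (1 / 2 : ℝ) ^ n := by
    intro n x
    set S : Set ℝ := θ '' {z | θ z + c * dist x z ≤ θ x}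
    have hne : S.Nonempty := ⟨θ x, x, by simp, rfl⟩
    have hbdd : BddBelow S := ⟨B, by rintro _ ⟨z, -, rfl⟩; exact hB z⟩
    obtain ⟨_, ⟨y, hy, rfl⟩, hlt⟩ := exists_lt_of_csInf_lt hne
      (lt_add_of_pos_right (sInf S) (by positivity : (0 : ℝ) < (1 / 2) ^ n))
    refine ⟨y, hy, fun z hz => ?_⟩
    have := csInf_le hbdd ⟨z, hz, rfl⟩
    linarith
  choose s hs hs' using hstep
  let u : ℕ → X := fun n => Nat.rec x₀ s n
  have hu : ∀ n, u (n + 1) = s n (u n) := fun n => rfl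
  have hdist : ∀ n, dist (u n) (u (n + 1)) ≤ (θ (u n) - θ (u (n + 1))) / c := by
    intro n
    rw [le_div_iff₀ hc, hu]
    linarith [hs n (u n)]
  have hsum : Summable fun n => (θ (u n) - θ (u (n + 1))) / c := by
    refine summable_of_sum_range_le (c := (θ (u 0) - B) / c)
      (fun n => dist_nonneg.trans (hdist n)) fun n => ?_
    rw [← Finset.sum_div, Finset.sum_range_sub']
    gcongr
    exact hB _
  obtain ⟨y, hy⟩ := cauchySeq_tendsto_of_complete (cauchySeq_of_dist_le_of_summable _ hdist hsum)
  have hmono : ∀ n k, θ (u (n + k)) + c * dist (u n) (u (n + k)) ≤ θ (u n) := by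
    intro n k
    induction k with
    | zero => simp
    | succ k ih =>
      have h₁ := hs (n + k) (u (n + k))
      rw [← hu] at h₁
      have h₂ := mul_le_mul_of_nonneg_left
        (dist_triangle (u n) (u (n + k)) (u (n + k + 1))) hc.le
      rw [← add_assoc]
      linarith
  have hlim : ∀ n, θ y + c * dist (u n) y ≤ θ (u n) := by
    intro n
    have hy' : Tendsto (fun k => u (n + k)) atTop (𝓝 y) := by
      simpa only [add_comm n] using (tendsto_add_atTop_iff_nat n).2 hy
    exact le_of_tendsto (((hθ.tendsto y).comp hy').add
      ((tendsto_const_nhds.dist hy').const_mul c)) (Eventually.of_forall (hmono n))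
  refine ⟨y, ?_, fun z => ?_⟩
  · have h := hlim 0
    have : 0 ≤ c * dist (u 0) y := by positivity
    change θ y + c * dist (u 0) y ≤ θ x₀ at h
    linarith
  · by_contra! hz
    have hle : ∀ n, θ y ≤ θ z + (1 / 2 : ℝ) ^ n := by
      intro n
      have h₁ := mul_le_mul_of_nonneg_left (dist_triangle (u n) y z) hc.le
      have h₂ := hs' n (u n) z (by linarith [hlim n])
      rw [← hu] at h₂
      have h₃ : 0 ≤ c * dist (u (n + 1)) y := by positivity
      linarith [hlim (n + 1)]
    have : θ y ≤ θ z + 0 := ge_of_tendsto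
      ((tendsto_pow_atTop_nhds_zero_of_lt_one (by norm_num : (0 : ℝ) ≤ 1 / 2)
        (by norm_num)).const_add (θ z)) (Eventually.of_forall hle)
    have h₀ : 0 ≤ c * dist y z := by positivity
    linarith

/-- The differentiable form of Ekeland's variational principle. -/
theorem exists_forall_neg_mul_norm_le_fderiv {E : Type*} [NormedAddCommGroup E] [NormedSpace ℝ E]
    [CompleteSpace E] {θ : E → ℝ} (hθ : Differentiable ℝ θ) {B : ℝ} (hB : ∀ x, B ≤ θ x)
    {c : ℝ} (hc : 0 < c) (x₀ : E) :
    ∃ y, θ y ≤ θ x₀ ∧ ∀ v, -(c * ‖v‖) ≤ fderiv ℝ θ y v := by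
  obtain ⟨y, hy₀, hy⟩ := exists_forall_le_add_mul_dist hθ.continuous hB hc x₀
  refine ⟨y, hy₀, fun v => ?_⟩
  have hlim := ((hθ y).hasFDerivAt.hasLineDerivAt v).tendsto_slope_zero_right
  refine ge_of_tendsto hlim ?_
  filter_upwards [self_mem_nhdsWithin] with t (ht : 0 < t)
  have h := hy (y + t • v)
  rw [dist_self_add_right, norm_smul, Real.norm_of_nonneg ht.le] at h
  simp only [smul_eq_mul]
  rw [inv_mul_eq_div, le_div_iff₀ ht]
  linarith

section ConvexGradient

variable {H : Type*} [NormedAddCommGroup H] [InnerProductSpace ℝ H] [CompleteSpace H]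

theorem ConvexOn.add_inner_gradient_le {f : H → ℝ} (hf : ConvexOn ℝ univ f)
    (hd : Differentiable ℝ f) (x y : H) : f x + ⟪gradient f x, y - x⟫ ≤ f y := by
  have hlim := ((hd x).hasFDerivAt.hasLineDerivAt (y - x)).tendsto_slope_zero_right
  rw [inner_gradient_left]
  have : fderiv ℝ f x (y - x) ≤ f y - f x := by
    refine le_of_tendsto hlim ?_
    filter_upwards [Ioo_mem_nhdsGT (zero_lt_one : (0 : ℝ) < 1)] with t ht
    have h := hf.2 (mem_univ x) (mem_univ y) (sub_nonneg.2 ht.2.le) ht.1.le (by ring)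
    have hxy : (1 - t) • x + t • y = x + t • (y - x) := by module
    rw [hxy] at h
    simp only [smul_eq_mul] at h ⊢
    rw [inv_mul_eq_div, div_le_iff₀ ht.1]
    linarith
  linarith

theorem ConvexOn.inner_gradient_sub_nonneg {f : H → ℝ} (hf : ConvexOn ℝ univ f)
    (hd : Differentiable ℝ f) (x y : H) : 0 ≤ ⟪gradient f y - gradient f x, y - x⟫ := by
  have h₁ := hf.add_inner_gradient_le hd x y
  have h₂ := hf.add_inner_gradient_le hd y x
  rw [← neg_sub y x, inner_neg_right] at h₂
  rw [inner_sub_left]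
  linarith

theorem fderiv_sub_inner_const {f : H → ℝ} (hd : Differentiable ℝ f) (ξ y v : H) :
    fderiv ℝ (fun x => f x - ⟪ξ, x⟫) y v = ⟪gradient f y - ξ, v⟫ := by
  have h : HasFDerivAt (fun x => f x - ⟪ξ, x⟫) (fderiv ℝ f y - innerSL ℝ ξ) y :=
    (hd y).hasFDerivAt.sub (innerSL ℝ ξ).hasFDerivAt
  rw [h.fderiv, inner_sub_left, inner_gradient_left]
  simp

theorem mem_closure_range_gradient {f : H → ℝ} (hd : Differentiable ℝ f) {ξ : H} {B : ℝ}
    (hB : ∀ x, B ≤ f x - ⟪ξ, x⟫) : ξ ∈ closure (range (gradient f)) := by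
  refine Metric.mem_closure_iff.2 fun ε hε => ?_
  have hd' : Differentiable ℝ fun x => f x - ⟪ξ, x⟫ :=
    hd.sub (innerSL ℝ ξ).differentiable
  obtain ⟨y, -, hy⟩ := exists_forall_neg_mul_norm_le_fderiv hd' hB (half_pos hε) 0
  refine ⟨_, mem_range_self y, ?_⟩
  have h := hy (-(gradient f y - ξ))
  rw [fderiv_sub_inner_const hd, inner_neg_right, real_inner_self_eq_norm_sq, norm_neg] at h
  rw [dist_eq_norm, norm_sub_rev]
  nlinarith [norm_nonneg (gradient f y - ξ)]

theorem ConvexOn.convex_closure_range_gradient {f : H → ℝ} (hf : ConvexOn ℝ univ f)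
    (hd : Differentiable ℝ f) : Convex ℝ (closure (range (gradient f))) := by
  intro a ha b hb s t hs ht hst
  have hmap : Continuous fun p : H × H => s • p.1 + t • p.2 := by fun_prop
  have hab : (a, b) ∈ closure (range (gradient f) ×ˢ range (gradient f)) := by
    rw [closure_prod_eq]
    exact ⟨ha, hb⟩
  have h := map_mem_closure (t := closure (range (gradient f))) hmap hab ?_
  · simpa using h
  rintro ⟨_, _⟩ ⟨⟨x, rfl⟩, ⟨y, rfl⟩⟩
  refine mem_closure_range_gradient hd
    (B := s * (f x - ⟪gradient f x, x⟫) + t * (f y - ⟪gradient f y, y⟫)) fun z => ?_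
  have h₁ := mul_le_mul_of_nonneg_left (hf.add_inner_gradient_le hd x z) hs
  have h₂ := mul_le_mul_of_nonneg_left (hf.add_inner_gradient_le hd y z) ht
  have h₃ : f z = s * f z + t * f z := by rw [← add_mul, hst, one_mul]
  simp only [inner_add_left, real_inner_smul_left, inner_sub_right] at h₁ h₂ ⊢
  linarith

omit [CompleteSpace H] in
theorem norm_sq_le_inner_of_forall_norm_le {K : Set H} (hK : Convex ℝ K) {p q : H} (hp : p ∈ K)
    (hmin : ∀ q ∈ K, ‖p‖ ≤ ‖q‖) (hq : q ∈ K) : ‖p‖ ^ 2 ≤ ⟪p, q⟫ := by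
  have hinf : ‖(0 : H) - p‖ = ⨅ w : K, ‖(0 : H) - w‖ := by
    have : Nonempty K := ⟨⟨p, hp⟩⟩
    refine le_antisymm (le_ciInf fun w => by simpa using hmin w w.2) ?_
    exact ciInf_le (f := fun w : K => ‖(0 : H) - w‖)
      ⟨0, by rintro _ ⟨w, rfl⟩; exact norm_nonneg _⟩ ⟨p, hp⟩
  have h := (norm_eq_iInf_iff_real_inner_le_zero hK hp).1 hinf q hq
  rw [zero_sub, inner_neg_left, inner_sub_right, real_inner_self_eq_norm_sq] at h
  linarith

/-- The Riesz isomorphism of a real Hilbert space, from the dual to the space, as a linear map. -/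
noncomputable def rieszCLM (H : Type*) [NormedAddCommGroup H] [InnerProductSpace ℝ H]
    [CompleteSpace H] : (H →L[ℝ] ℝ) →L[ℝ] H :=
  LinearMap.mkContinuous
    { toFun := fun l => (InnerProductSpace.toDual ℝ H).symm l
      map_add' := fun l m => by simp
      map_smul' := fun r l => by simp } 1 (fun l => by simp)

theorem inner_rieszCLM (l : H →L[ℝ] ℝ) (v : H) : ⟪rieszCLM H l, v⟫ = l v :=
  InnerProductSpace.toDual_symm_apply

theorem inner_rieszCLM_right (l : H →L[ℝ] ℝ) (v : H) : ⟪v, rieszCLM H l⟫ = l v := by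
  rw [real_inner_comm, inner_rieszCLM]

theorem ContDiff.hasFDerivAt_gradient {f : H → ℝ} (hf : ContDiff ℝ 2 f) (x : H) :
    HasFDerivAt (gradient f) ((rieszCLM H).comp (fderiv ℝ (fderiv ℝ f) x)) x := by
  have h : Differentiable ℝ (fderiv ℝ f) :=
    (hf.fderiv_right (m := 1) (by norm_num)).differentiable (by norm_num)
  exact (rieszCLM H).hasFDerivAt.comp x (h x).hasFDerivAt

theorem ConvexOn.fderiv_fderiv_nonneg {f : H → ℝ} (hf : ConvexOn ℝ univ f)
    (hs : ContDiff ℝ 2 f) (x v : H) : 0 ≤ fderiv ℝ (fderiv ℝ f) x v v := by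
  have hlim := ((hs.hasFDerivAt_gradient x).hasLineDerivAt v).tendsto_slope_zero_right
  have hlim' := hlim.inner (𝕜 := ℝ) (tendsto_const_nhds (x := v))
  simp only [ContinuousLinearMap.comp_apply, inner_rieszCLM] at hlim'
  refine ge_of_tendsto hlim' ?_
  filter_upwards [self_mem_nhdsWithin] with t (ht : 0 < t)
  have h := hf.inner_gradient_sub_nonneg (hs.differentiable (by norm_num)) x (x + t • v)
  rw [add_sub_cancel_left, real_inner_smul_right] at h
  simp only [real_inner_smul_left]
  exact mul_nonneg (inv_nonneg.2 ht.le) (nonneg_of_mul_nonneg_right h ht)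

/-- If `f` and `g` have equal gradient norms, then `‖∇f - ∇g‖ ^ 2` does not decrease along the
direction of steepest descent of `f`, when `g` is convex. -/
theorem exists_hasFDerivAt_norm_sq_gradient_sub {f g : H → ℝ} (hg : ConvexOn ℝ univ g)
    (hfs : ContDiff ℝ 2 f) (hgs : ContDiff ℝ 2 g) (hn : ∀ x, ‖gradient f x‖ = ‖gradient g x‖)
    (x : H) :
    ∃ L : H →L[ℝ] ℝ, HasFDerivAt (fun x => ‖gradient f x - gradient g x‖ ^ 2) L x ∧
      0 ≤ L (-gradient f x) := by
  have hF := hfs.hasFDerivAt_gradient x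
  have hG := hgs.hasFDerivAt_gradient x
  have hsF := (hfs.contDiffAt (x := x)).isSymmSndFDerivAt (by simp)
  have hsG := (hgs.contDiffAt (x := x)).isSymmSndFDerivAt (by simp)
  refine ⟨_, (hF.sub hG).norm_sq, ?_⟩
  have key : ∀ w, fderiv ℝ (fderiv ℝ f) x w (gradient f x) =
      fderiv ℝ (fderiv ℝ g) x w (gradient g x) := by
    intro w
    have h₁ := hF.norm_sq
    have h₂ := hG.norm_sq
    simp only [hn] at h₁
    have h := DFunLike.congr_fun (h₁.unique h₂) w
    simp only [smul_apply, ContinuousLinearMap.comp_apply, coe_innerSL_apply,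
      inner_rieszCLM_right, nsmul_eq_mul] at h
    simpa using h
  have hpos := hg.fderiv_fderiv_nonneg hgs x (gradient f x - gradient g x)
  rw [map_sub (fderiv ℝ (fderiv ℝ g) x (gradient f x - gradient g x))] at hpos
  have hk := key (gradient f x - gradient g x)
  have e₁ := hsF (gradient f x) (gradient f x - gradient g x)
  have e₂ := hsG (gradient f x) (gradient f x - gradient g x)
  simp only [smul_apply, ContinuousLinearMap.comp_apply, coe_innerSL_apply,
    sub_apply, Pi.sub_apply, map_neg, inner_sub_right, inner_rieszCLM_right, nsmul_eq_mul,
    Nat.cast_ofNat]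
  linarith

omit [CompleteSpace H] in
theorem norm_sub_sq_le_of_norm_sq_le_inner {p u v : H} (hn : ‖u‖ = ‖v‖) (hu : ‖p‖ ^ 2 ≤ ⟪p, u⟫)
    (hv : ‖p‖ ^ 2 ≤ ⟪p, v⟫) : ‖u - v‖ ^ 2 ≤ 4 * (‖u‖ ^ 2 - ‖p‖ ^ 2) := by
  have h : 0 ≤ ‖(u + v) - (2 : ℝ) • p‖ ^ 2 := by positivity
  rw [norm_sub_sq_real, norm_add_sq_real, norm_smul, real_inner_smul_right, inner_add_left,
    real_inner_comm p u, real_inner_comm p v, ← hn, Real.norm_ofNat] at h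
  rw [norm_sub_sq_real, ← hn]
  nlinarith

theorem gradient_eq_of_norm_gradient_eq {f g : H → ℝ} (hf : ConvexOn ℝ univ f)
    (hg : ConvexOn ℝ univ g) (hfs : ContDiff ℝ 2 f) (hgs : ContDiff ℝ 2 g)
    (hn : ∀ x, ‖gradient f x‖ = ‖gradient g x‖) {p : H} (hp : p ∈ closure (range (gradient f)))
    (hpf : ∀ x, ‖p‖ ^ 2 ≤ ⟪p, gradient f x⟫) (hpg : ∀ x, ‖p‖ ^ 2 ≤ ⟪p, gradient g x⟫) (x₀ : H) :
    gradient f x₀ = gradient g x₀ := by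
  by_contra hne
  have hd : Differentiable ℝ f := hfs.differentiable (by norm_num)
  set φ : H → ℝ := fun x => ‖gradient f x - gradient g x‖ ^ 2 with hφ
  have hφ_nonneg : ∀ x, 0 ≤ φ x := fun x => by positivity
  have hφ₀ : 0 < φ x₀ := by
    have := norm_pos_iff.2 (sub_ne_zero.2 hne)
    positivity
  set m : ℝ := √(‖p‖ ^ 2 + φ x₀ / 8)
  have hm_sq : m ^ 2 = ‖p‖ ^ 2 + φ x₀ / 8 := Real.sq_sqrt (by positivity)
  have hm_nonneg : 0 ≤ m := Real.sqrt_nonneg _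
  have hpm : ‖p‖ < m := by
    refine lt_of_pow_lt_pow_left₀ 2 hm_nonneg ?_
    linarith
  obtain ⟨_, ⟨z, rfl⟩, hz⟩ := Metric.mem_closure_iff.1 hp (m - ‖p‖) (sub_pos.2 hpm)
  have hzm : ‖gradient f z‖ < m := by
    rw [dist_eq_norm, norm_sub_rev] at hz
    linarith [norm_le_norm_add_norm_sub' (gradient f z) p]
  set ψ : H → ℝ := fun x => f x - ⟪gradient f z, x⟫ with hψ
  have hψd : Differentiable ℝ ψ := hd.sub (innerSL ℝ (gradient f z)).differentiable
  have hψB : ∀ x, ψ z ≤ ψ x := by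
    intro x
    have h := hf.add_inner_gradient_le hd z x
    rw [inner_sub_right] at h
    simp only [hψ]
    linarith
  set δ : ℝ := (1 + φ x₀ / 2)⁻¹ - (1 + φ x₀)⁻¹ with hδ
  have hδ_pos : 0 < δ := sub_pos.2 (inv_strictAnti₀ (by positivity) (by linarith))
  set r : ℝ := (ψ x₀ - ψ z + 1) / δ
  have hr_pos : 0 < r := div_pos (by linarith [hψB x₀]) hδ_pos
  have hrδ : r * δ = ψ x₀ - ψ z + 1 := div_mul_cancel₀ _ hδ_pos.ne'
  have hθ : ∀ x, ∃ L : H →L[ℝ] ℝ,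
      HasFDerivAt (fun x => ψ x + r * (1 + φ x)⁻¹) L x ∧
        L (-gradient f x) ≤ ⟪gradient f x - gradient f z, -gradient f x⟫ := by
    intro x
    obtain ⟨L, hL, hL_nonneg⟩ := exists_hasFDerivAt_norm_sq_gradient_sub hg hfs hgs hn x
    have hpos : 0 < 1 + φ x := by linarith [hφ_nonneg x]
    have h := (hψd x).hasFDerivAt.add
      (((hasDerivAt_inv hpos.ne').comp_hasFDerivAt x (hL.const_add 1)).const_mul r)
    refine ⟨_, h, ?_⟩
    simp only [add_apply, smul_apply, smul_eq_mul]
    rw [fderiv_sub_inner_const hd]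
    have : 0 ≤ r * (((1 + φ x) ^ 2)⁻¹ * L (-gradient f x)) := by positivity
    linarith
  obtain ⟨y, hy₀, hy⟩ := exists_forall_neg_mul_norm_le_fderiv
    (θ := fun x => ψ x + r * (1 + φ x)⁻¹) (B := ψ z)
    (fun x => (hθ x).choose_spec.1.differentiableAt)
    (fun x => by
      have : 0 ≤ r * (1 + φ x)⁻¹ := by have := hφ_nonneg x; positivity
      linarith [hψB x])
    (half_pos (sub_pos.2 hzm)) x₀
  have hφy : φ x₀ / 2 ≤ φ y := by
    by_contra! h
    have h₁ : (1 + φ x₀ / 2)⁻¹ ≤ (1 + φ y)⁻¹ :=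
      inv_anti₀ (by linarith [hφ_nonneg y]) (by linarith)
    have h₂ := mul_le_mul_of_nonneg_left h₁ hr_pos.le
    rw [hδ, mul_sub] at hrδ
    linarith [hψB y]
  have hmy : m ≤ ‖gradient f y‖ := by
    refine le_of_sq_le_sq ?_ (norm_nonneg _)
    have := norm_sub_sq_le_of_norm_sq_le_inner (hn y) (hpf y) (hpg y)
    simp only [hφ] at hφy hm_sq
    linarith
  obtain ⟨L, hL, hLy⟩ := hθ y
  have h := hy (-gradient f y)
  rw [hL.fderiv] at h
  have h₁ := h.trans hLy
  rw [inner_neg_right, inner_sub_left, real_inner_self_eq_norm_sq, norm_neg] at h₁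
  have h₂ := real_inner_le_norm (gradient f z) (gradient f y)
  have h₃ : 0 < ‖gradient f y‖ := by linarith [norm_nonneg p]
  nlinarith

end ConvexGradient

/-- **Determination of convex `C²` functions on a Hilbert space.**
If `f, g : H → ℝ` are convex, twice continuously differentiable,
have equal gradient norms everywhere, and have the same Crandall–Pazy direction
(the element of minimal norm of the closure of the range of the gradient),
then `f` and `g` differ by an additive constant. -/
theorem determination_C2_hilbert
    {H : Type*} [NormedAddCommGroup H] [InnerProductSpace ℝ H] [CompleteSpace H]
    (f g : H → ℝ)
    (hfconv : ConvexOn ℝ Set.univ f) (hgconv : ConvexOn ℝ Set.univ g)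
    (hfsmooth : ContDiff ℝ 2 f) (hgsmooth : ContDiff ℝ 2 g)
    (pf pg : H)
    (hpf : pf ∈ closure (Set.range (gradient f)) ∧
      ∀ q ∈ closure (Set.range (gradient f)), ‖pf‖ ≤ ‖q‖)
    (hpg : pg ∈ closure (Set.range (gradient g)) ∧
      ∀ q ∈ closure (Set.range (gradient g)), ‖pg‖ ≤ ‖q‖)
    (hnorm : ∀ x, ‖gradient f x‖ = ‖gradient g x‖)
    (hp : pf = pg) :
    ∃ c : ℝ, ∀ x, f x = g x + c := by
  subst hp
  have hfd : Differentiable ℝ f := hfsmooth.differentiable (by norm_num)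
  have hgd : Differentiable ℝ g := hgsmooth.differentiable (by norm_num)
  have hgrad : ∀ x, gradient f x = gradient g x :=
    gradient_eq_of_norm_gradient_eq hfconv hgconv hfsmooth hgsmooth hnorm hpf.1
      (fun x => norm_sq_le_inner_of_forall_norm_le (hfconv.convex_closure_range_gradient hfd)
        hpf.1 hpf.2 (subset_closure (mem_range_self x)))
      (fun x => norm_sq_le_inner_of_forall_norm_le (hgconv.convex_closure_range_gradient hgd)
        hpg.1 hpg.2 (subset_closure (mem_range_self x)))
  refine ⟨f 0 - g 0, fun x => ?_⟩
  have hzero : ∀ x, fderiv ℝ (fun x => f x - g x) x = 0 := by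
    intro x
    rw [fderiv_fun_sub (hfd x) (hgd x), ← toDual_gradient, ← toDual_gradient, hgrad, sub_self]
  have h := is_const_of_fderiv_eq_zero (𝕜 := ℝ) (hfd.sub hgd) hzero x 0
  simp only [Pi.sub_apply] at h
  linarith
end

section
/- Let H be a real Hilbert space and f : H → ℝ ∪ {+∞} a proper lower semicontinuous convex function. Then for every sequence (x_n) in dom ∂f such that s_f(x_n) converges to inf_{y ∈ H} s_f(y), the sequence (∂°f(x_n)) converges strongly to the Crandall–Pazy direction p_f. In particular, for every subgradient curve γ of f one has ∂°f(γ(t)) → p_f as t → +∞. -/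
open Set Filter MeasureTheory RealInnerProductSpace
open scoped ENNReal NNReal Classical

variable {H : Type*} [NormedAddCommGroup H] [InnerProductSpace ℝ H] [CompleteSpace H]

/-- The convex subdifferential of an extended-real-valued function `f` at `x`. -/
def SubdiffE (f : H → EReal) (x : H) : Set H :=
  {p | ∀ y, f x + ((⟪p, y - x⟫ : ℝ) : EReal) ≤ f y}

/-- Convexity for extended-real-valued functions. -/
def ConvexE (f : H → EReal) : Prop :=
  ∀ x y : H, ∀ a b : ℝ, 0 ≤ a → 0 ≤ b → a + b = 1 →
    f (a • x + b • y) ≤ (a : EReal) * f x + (b : EReal) * f y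

/-- The element of minimal norm of a set (defined when it exists, `0` otherwise).
For a nonempty closed convex subset of a Hilbert space this is the projection of `0`. -/
noncomputable def minNormElt (S : Set H) : H :=
  if h : ∃ p ∈ S, ∀ q ∈ S, ‖p‖ ≤ ‖q‖ then h.choose else 0

/-- The slope of `f` at `x`: `dist(0, ∂f(x))`, with value `⊤` when `∂f(x) = ∅`. -/
noncomputable def slopeE (f : H → EReal) (x : H) : ℝ≥0∞ :=
  ⨅ p ∈ SubdiffE f x, (‖p‖₊ : ℝ≥0∞)

/-- `γ : [0,∞) → H` is the subgradient curve of `f` emanating from `x`: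
a locally absolutely continuous curve with `γ 0 = x` and `γ' t ∈ -∂f(γ t)` a.e. -/
def IsSubgradientCurve (f : H → EReal) (x : H) (γ : ℝ → H) : Prop :=
  γ 0 = x ∧ ContinuousOn γ (Set.Ici 0) ∧
  ∃ v : ℝ → H,
    (∀ t > 0, MeasureTheory.IntegrableOn v (Set.Ioc 0 t)) ∧
    (∀ t ≥ 0, γ t = x + ∫ s in Set.Ioc 0 t, v s) ∧
    (∀ᵐ t ∂(MeasureTheory.volume.restrict (Set.Ioi (0:ℝ))), -v t ∈ SubdiffE f (γ t))

open scoped Topology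

/-! ### Subdifferentials of extended-real-valued functions -/

omit [CompleteSpace H] in
lemma mem_SubdiffE_iff {f : H → EReal} {x p : H} :
    p ∈ SubdiffE f x ↔ ∀ (y : H) (r : ℝ), f y ≤ r → f x ≤ ((r - ⟪p, y - x⟫ : ℝ) : EReal) := by
  refine ⟨fun h y r hr => ?_, fun h y => ?_⟩
  · have h' := (h y).trans hr
    induction hfx : f x with
    | bot => exact bot_le
    | top => simp [hfx] at h'
    | coe a =>
      rw [hfx] at h'
      norm_cast at h' ⊢
      linarith
  · induction hfy : f y with
    | top => exact le_top
    | bot =>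
      have hx : f x = ⊥ := by
        rw [EReal.eq_bot_iff_forall_lt]
        intro a
        have := h y (a - 1 + ⟪p, y - x⟫) (by simp [hfy])
        refine this.trans_lt ?_
        norm_cast
        linarith
      simp [hx]
    | coe b =>
      have h' := h y b hfy.le
      induction hfx : f x with
      | bot => simp
      | top => simp [hfx, -EReal.coe_sub] at h'
      | coe a =>
        rw [hfx] at h'
        norm_cast at h' ⊢
        linarith

omit [CompleteSpace H] in
lemma exists_coe_eq_of_mem_SubdiffE {f : H → EReal} (hproper : ∃ y, f y ≠ ⊤)
    (hnobot : ∀ y, f y ≠ ⊥) {x p : H} (hp : p ∈ SubdiffE f x) : ∃ a : ℝ, f x = a := by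
  obtain ⟨y, hy⟩ := hproper
  have h := mem_SubdiffE_iff.1 hp y (f y).toReal (EReal.coe_toReal hy (hnobot y)).ge
  have hx : f x ≠ ⊤ := fun h' => by simp [h', -EReal.coe_sub] at h
  exact ⟨(f x).toReal, (EReal.coe_toReal hx (hnobot x)).symm⟩

omit [CompleteSpace H] in
lemma add_inner_le_of_mem_SubdiffE {f : H → EReal} {x p : H} (hp : p ∈ SubdiffE f x)
    {a : ℝ} (ha : f x = a) {y : H} {r : ℝ} (hr : f y ≤ r) : a + ⟪p, y - x⟫ ≤ r := by
  have h := mem_SubdiffE_iff.1 hp y r hr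
  rw [ha] at h
  norm_cast at h
  linarith

omit [CompleteSpace H] in
lemma inner_sub_nonneg_of_mem_SubdiffE {f : H → EReal} (hproper : ∃ y, f y ≠ ⊤)
    (hnobot : ∀ y, f y ≠ ⊥) {x y p q : H} (hp : p ∈ SubdiffE f x) (hq : q ∈ SubdiffE f y) :
    0 ≤ ⟪x - y, p - q⟫ := by
  obtain ⟨a, ha⟩ := exists_coe_eq_of_mem_SubdiffE hproper hnobot hp
  obtain ⟨b, hb⟩ := exists_coe_eq_of_mem_SubdiffE hproper hnobot hq
  have h1 := add_inner_le_of_mem_SubdiffE hp ha hb.le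
  have h2 := add_inner_le_of_mem_SubdiffE hq hb ha.le
  simp only [inner_sub_left, inner_sub_right, real_inner_comm] at *
  linarith

omit [CompleteSpace H] in
lemma isClosed_SubdiffE (f : H → EReal) (x : H) : IsClosed (SubdiffE f x) := by
  have h : SubdiffE f x =
      ⋂ (y : H) (r : ℝ) (_ : f y ≤ r), {p | f x ≤ ((r - ⟪p, y - x⟫ : ℝ) : EReal)} := by
    ext p
    simp [mem_SubdiffE_iff]
  rw [h]
  refine isClosed_iInter fun y => isClosed_iInter fun r => isClosed_iInter fun _ => ?_
  exact isClosed_le continuous_const (continuous_coe_real_ereal.comp (by fun_prop))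

omit [CompleteSpace H] in
lemma convex_SubdiffE (f : H → EReal) (x : H) : Convex ℝ (SubdiffE f x) := by
  intro p hp q hq a b ha hb hab
  rw [mem_SubdiffE_iff] at *
  intro y r hr
  have h1 := hp y r hr
  have h2 := hq y r hr
  induction hfx : f x with
  | bot => exact bot_le
  | top => simp [hfx, -EReal.coe_sub] at h1
  | coe c =>
    rw [hfx] at h1 h2
    norm_cast at h1 h2 ⊢
    rw [inner_add_left, real_inner_smul_left, real_inner_smul_left]
    obtain rfl : b = 1 - a := by linarith
    nlinarith

lemma minNormElt_SubdiffE_spec {f : H → EReal} {x : H} (h : (SubdiffE f x).Nonempty) :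
    minNormElt (SubdiffE f x) ∈ SubdiffE f x ∧
      ∀ q ∈ SubdiffE f x, ‖minNormElt (SubdiffE f x)‖ ≤ ‖q‖ := by
  have hex : ∃ p ∈ SubdiffE f x, ∀ q ∈ SubdiffE f x, ‖p‖ ≤ ‖q‖ := by
    obtain ⟨p, hp, hmin⟩ := exists_norm_eq_iInf_of_complete_convex h
      (isClosed_SubdiffE f x).isComplete (convex_SubdiffE f x) 0
    refine ⟨p, hp, fun q hq => ?_⟩
    simp only [zero_sub, norm_neg] at hmin
    rw [hmin]
    exact ciInf_le ⟨0, by rintro _ ⟨w, rfl⟩; positivity⟩ (⟨q, hq⟩ : SubdiffE f x)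
  rw [minNormElt, dif_pos hex]
  exact hex.choose_spec

/-- A bounded ultrafilter in a Hilbert space has a weak limit. -/
lemma exists_weak_limit_of_bounded {ι : Type*} (l : Ultrafilter ι) {p : ι → H} {L : ℝ}
    (hL : ∀ᶠ i in l, ‖p i‖ ≤ L) :
    ∃ q : H, ‖q‖ ≤ L ∧ ∀ y, Tendsto (fun i => ⟪p i, y⟫) l (𝓝 ⟪q, y⟫) := by
  let u : ι → WeakDual ℝ H := fun i =>
    StrongDual.toWeakDual (InnerProductSpace.toDual ℝ H (p i))
  have hmem : ∀ᶠ i in l, u i ∈ WeakDual.toStrongDual ⁻¹' Metric.closedBall (0 : StrongDual ℝ H) L := by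
    filter_upwards [hL] with i hi
    simpa [u] using hi
  obtain ⟨φ, hφ, hlim⟩ := isCompact_iff_ultrafilter_le_nhds'.1
    (WeakDual.isCompact_closedBall (0 : StrongDual ℝ H) L) (l.map u) hmem
  refine ⟨(InnerProductSpace.toDual ℝ H).symm (WeakDual.toStrongDual φ), by simpa using hφ,
    fun y => ?_⟩
  have h := ((WeakDual.eval_continuous y).tendsto φ).comp hlim
  rw [InnerProductSpace.toDual_symm_apply]
  exact h

/-- The graph of the subdifferential is closed for strong convergence of points and boundedness of
subgradients. -/
lemma exists_mem_SubdiffE_of_tendsto {f : H → EReal} (hlsc : LowerSemicontinuous f)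
    {ι : Type*} {l : Filter ι} [l.NeBot] {z p : ι → H} {x : H} {L : ℝ}
    (hz : Tendsto z l (𝓝 x)) (hp : ∀ᶠ i in l, p i ∈ SubdiffE f (z i))
    (hL : ∀ᶠ i in l, ‖p i‖ ≤ L) : ∃ q ∈ SubdiffE f x, ‖q‖ ≤ L := by
  have hU : (Ultrafilter.of l : Filter ι) ≤ l := Ultrafilter.of_le l
  obtain ⟨q, hqL, hq⟩ := exists_weak_limit_of_bounded (Ultrafilter.of l) (hU hL)
  refine ⟨q, mem_SubdiffE_iff.2 fun y r hr => ?_, hqL⟩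
  have hz' := hz.mono_left hU
  have hsmall : Tendsto (fun i => ⟪p i, x - z i⟫) (Ultrafilter.of l) (𝓝 0) := by
    have hd : Tendsto (fun i => L * ‖x - z i‖) (Ultrafilter.of l) (𝓝 0) := by
      simpa using ((tendsto_const_nhds (x := x)).sub hz').norm.const_mul L
    refine squeeze_zero_norm' ?_ hd
    filter_upwards [hU hL] with i hi
    exact (norm_inner_le_norm _ _).trans (by gcongr)
  have hlim : Tendsto (fun i => r - ⟪p i, y - z i⟫) (Ultrafilter.of l) (𝓝 (r - ⟪q, y - x⟫)) := by
    have := (hq (y - x)).add hsmall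
    refine Tendsto.congr (fun i => ?_) (tendsto_const_nhds.sub (by simpa using this))
    rw [← inner_add_right]
    congr 2
    abel
  have hpair := hz'.prodMk_nhds ((continuous_coe_real_ereal.tendsto _).comp hlim)
  refine hlsc.isClosed_epigraph.mem_of_tendsto hpair ?_
  filter_upwards [hU hp] with i hi
  exact mem_SubdiffE_iff.1 hi y r hr

/-! ### Absolutely continuous functions -/

lemma AbsolutelyContinuousOnInterval.of_dist_le {X Y : Type*} [PseudoMetricSpace X]
    [PseudoMetricSpace Y] {g : ℝ → X} {k : ℝ → Y} {a b : ℝ}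
    (hk : AbsolutelyContinuousOnInterval k a b)
    (h : ∀ s ∈ uIcc a b, ∀ t ∈ uIcc a b, dist (g s) (g t) ≤ dist (k s) (k t)) :
    AbsolutelyContinuousOnInterval g a b := by
  rw [absolutelyContinuousOnInterval_iff] at *
  intro ε hε
  obtain ⟨δ, hδ, hδ'⟩ := hk ε hε
  refine ⟨δ, hδ, fun E hE hlt => (Finset.sum_le_sum fun i hi => ?_).trans_lt (hδ' E hE hlt)⟩
  have := hE.1 i hi
  exact h _ this.1 _ this.2

lemma AbsolutelyContinuousOnInterval.of_sub_eq_integral {E : Type*} [NormedAddCommGroup E]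
    [NormedSpace ℝ E] {g w : ℝ → E} {a b : ℝ} (hw : IntervalIntegrable w volume a b)
    (h : ∀ s ∈ uIcc a b, ∀ t ∈ uIcc a b, g t - g s = ∫ u in s..t, w u) :
    AbsolutelyContinuousOnInterval g a b := by
  refine (hw.norm.absolutelyContinuousOnInterval_intervalIntegral
    (c := a) left_mem_uIcc).of_dist_le fun s hs t ht => ?_
  have hi : ∀ u ∈ uIcc a b, IntervalIntegrable (fun x => ‖w x‖) volume a u := fun u hu =>
    hw.norm.mono_set (uIcc_subset_uIcc left_mem_uIcc hu)
  rw [dist_comm, dist_eq_norm, h s hs t ht, dist_comm, Real.dist_eq,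
    intervalIntegral.integral_interval_sub_left (hi t ht) (hi s hs)]
  exact intervalIntegral.norm_integral_le_abs_integral_norm

lemma AbsolutelyContinuousOnInterval.norm {E : Type*} [NormedAddCommGroup E] {g : ℝ → E}
    {a b : ℝ} (hg : AbsolutelyContinuousOnInterval g a b) :
    AbsolutelyContinuousOnInterval (fun t => ‖g t‖) a b :=
  hg.of_dist_le fun _ _ _ _ => (dist_norm_norm_le _ _).trans_eq (dist_eq_norm _ _).symm

lemma AbsolutelyContinuousOnInterval.norm_sq {E : Type*} [NormedAddCommGroup E] {g : ℝ → E}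
    {a b : ℝ} (hg : AbsolutelyContinuousOnInterval g a b) :
    AbsolutelyContinuousOnInterval (fun t => ‖g t‖ ^ 2) a b := by
  simpa only [pow_two] using hg.norm.fun_mul hg.norm

lemma AbsolutelyContinuousOnInterval.le_of_ae_deriv_nonpos {φ : ℝ → ℝ} {a b : ℝ} (hab : a ≤ b)
    (hφ : AbsolutelyContinuousOnInterval φ a b)
    (h : ∀ᵐ t, t ∈ Icc a b → deriv φ t ≤ 0) : φ b ≤ φ a := by
  have hint := hφ.integral_deriv_eq_sub
  rw [intervalIntegral.integral_of_le hab] at hint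
  have : ∫ t in Ioc a b, deriv φ t ≤ 0 := by
    refine integral_nonpos_of_ae ?_
    filter_upwards [ae_restrict_of_ae h, ae_restrict_mem measurableSet_Ioc] with t h1 h2
    exact h1 (Ioc_subset_Icc_self h2)
  linarith

/-! ### The closure of the range of the subdifferential -/

/-- A lower bounded, lower semicontinuous convex function perturbed by a linear term and a positive
multiple of a squared distance attains its infimum. The function is given through its epigraph. -/
lemma exists_min_add_sq {f : H → EReal} (hproper : ∃ y, f y ≠ ⊤) (hnobot : ∀ y, f y ≠ ⊥)
    (hlsc : LowerSemicontinuous f) (hconv : ConvexE f) {p : H} {c : ℝ}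
    (hc : ∀ (y : H) (r : ℝ), f y ≤ r → ⟪p, y⟫ + c ≤ r) (x₀ : H) {lam : ℝ} (hlam : 0 < lam) :
    ∃ (x : H) (a : ℝ), f x ≤ a ∧ ∀ (y : H) (r : ℝ), f y ≤ r →
      a - ⟪p, x⟫ + lam * ‖x - x₀‖ ^ 2 ≤ r - ⟪p, y⟫ + lam * ‖y - x₀‖ ^ 2 := by
  let G : H × ℝ → ℝ := fun z => z.2 - ⟪p, z.1⟫ + lam * ‖z.1 - x₀‖ ^ 2
  let E : Set (H × ℝ) := {z | f z.1 ≤ z.2}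
  obtain ⟨y₀, hy₀⟩ := hproper
  have hE : E.Nonempty := ⟨(y₀, (f y₀).toReal), (EReal.coe_toReal hy₀ (hnobot y₀)).ge⟩
  have hbdd : BddBelow (G '' E) := by
    refine ⟨c, ?_⟩
    rintro _ ⟨z, hz, rfl⟩
    have := hc z.1 z.2 hz
    have : 0 ≤ lam * ‖z.1 - x₀‖ ^ 2 := by positivity
    simp only [G]
    linarith
  set m := sInf (G '' E) with hm
  have hmle : ∀ z ∈ E, m ≤ G z := fun z hz => csInf_le hbdd (mem_image_of_mem _ hz)
  obtain ⟨g, -, hglim, hgE⟩ := exists_seq_tendsto_sInf (hE.image G) hbdd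
  choose z hzE hzg using hgE
  have hGz : Tendsto (fun n => G (z n)) atTop (𝓝 m) := by simpa [hzg] using hglim
  have hmid : ∀ i j, lam / 4 * ‖(z i).1 - (z j).1‖ ^ 2 ≤ (G (z i) + G (z j)) / 2 - m := by
    intro i j
    have hmem : ((1 / 2 : ℝ) • (z i).1 + (1 / 2 : ℝ) • (z j).1,
        1 / 2 * (z i).2 + 1 / 2 * (z j).2) ∈ E := by
      have h := hconv (z i).1 (z j).1 (1 / 2) (1 / 2) (by norm_num) (by norm_num) (by norm_num)
      refine h.trans ?_
      push_cast
      have hi : f (z i).1 ≤ ((z i).2 : EReal) := hzE i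
      have hj : f (z j).1 ≤ ((z j).2 : EReal) := hzE j
      have h0 : (0 : EReal) ≤ ((1 / 2 : ℝ) : EReal) := by
        rw [EReal.coe_nonneg]
        norm_num
      have := add_le_add (mul_le_mul_of_nonneg_left hi h0) (mul_le_mul_of_nonneg_left hj h0)
      simpa using this
    have h := hmle _ hmem
    have hpar := parallelogram_law_with_norm ℝ ((z i).1 - x₀) ((z j).1 - x₀)
    have hsum : (1 / 2 : ℝ) • (z i).1 + (1 / 2 : ℝ) • (z j).1 - x₀
        = (1 / 2 : ℝ) • ((z i).1 - x₀ + ((z j).1 - x₀)) := by module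
    have hdiff : (z i).1 - x₀ - ((z j).1 - x₀) = (z i).1 - (z j).1 := by abel
    rw [hdiff] at hpar
    simp only [G] at h ⊢
    rw [hsum, norm_smul, inner_add_right, real_inner_smul_right, real_inner_smul_right] at h
    norm_num at h
    nlinarith [hpar, h]
  have hcauchy : CauchySeq fun n => (z n).1 := by
    rw [Metric.cauchySeq_iff]
    intro ε hε
    have hev : ∀ᶠ n in atTop, G (z n) < m + lam / 4 * ε ^ 2 :=
      hGz.eventually_lt_const (by have : 0 < lam / 4 * ε ^ 2 := by positivity
                                  linarith)
    obtain ⟨N, hN⟩ := eventually_atTop.1 hev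
    refine ⟨N, fun i hi j hj => ?_⟩
    have h1 := hN i hi
    have h2 := hN j hj
    have h3 := hmid i j
    have h4 : lam / 4 * ‖(z i).1 - (z j).1‖ ^ 2 < lam / 4 * ε ^ 2 := by linarith
    rw [dist_eq_norm]
    exact lt_of_pow_lt_pow_left₀ 2 hε.le (lt_of_mul_lt_mul_left h4 (by positivity))
  obtain ⟨x, hx⟩ := cauchySeq_tendsto_of_complete hcauchy
  have hcont : Continuous fun y : H => ⟪p, y⟫ - lam * ‖y - x₀‖ ^ 2 := by fun_prop
  have hr : Tendsto (fun n => (z n).2) atTop (𝓝 (m + (⟪p, x⟫ - lam * ‖x - x₀‖ ^ 2))) := by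
    refine (hGz.add ((hcont.tendsto x).comp hx)).congr fun n => ?_
    simp only [G, Function.comp]
    ring
  refine ⟨x, m + (⟪p, x⟫ - lam * ‖x - x₀‖ ^ 2), ?_, fun y r hyr => ?_⟩
  · exact hlsc.isClosed_epigraph.mem_of_tendsto
      (hx.prodMk_nhds ((continuous_coe_real_ereal.tendsto _).comp hr))
      (Eventually.of_forall hzE)
  · have h := hmle (y, r) hyr
    simp only [G] at h
    linarith

/-- The slope of a continuous affine minorant of a proper lower semicontinuous convex function is a
limit of subgradients. -/
lemma mem_closure_iUnion_SubdiffE {f : H → EReal} (hproper : ∃ y, f y ≠ ⊤)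
    (hnobot : ∀ y, f y ≠ ⊥) (hlsc : LowerSemicontinuous f) (hconv : ConvexE f) {p : H} {c : ℝ}
    (hc : ∀ (y : H) (r : ℝ), f y ≤ r → ⟪p, y⟫ + c ≤ r) :
    p ∈ closure (⋃ y, SubdiffE f y) := by
  obtain ⟨x₀, hx₀⟩ := id hproper
  set r₀ := (f x₀).toReal
  have hr₀ : f x₀ ≤ r₀ := (EReal.coe_toReal hx₀ (hnobot x₀)).ge
  set C := r₀ - ⟪p, x₀⟫ - c with hC
  have hC0 : 0 ≤ C := by
    have := hc x₀ r₀ hr₀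
    linarith
  rw [Metric.mem_closure_iff]
  intro ε hε
  obtain ⟨lam, hlam, hlam'⟩ : ∃ lam : ℝ, 0 < lam ∧ 4 * lam * C < ε ^ 2 := by
    refine ⟨ε ^ 2 / (4 * (C + 1)), by positivity, ?_⟩
    rw [mul_div_assoc', div_mul_eq_mul_div, div_lt_iff₀ (by positivity)]
    nlinarith [pow_pos hε 2]
  obtain ⟨x, a, hxa, hmin⟩ := exists_min_add_sq hproper hnobot hlsc hconv hc x₀ hlam
  refine ⟨p - (2 * lam) • (x - x₀), mem_iUnion.2 ⟨x, ?_⟩, ?_⟩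
  · rw [mem_SubdiffE_iff]
    intro y r hyr
    refine hxa.trans ?_
    norm_cast
    have hseg : ∀ t : ℝ, 0 < t → t ≤ 1 →
        0 ≤ (r - a - ⟪p - (2 * lam) • (x - x₀), y - x⟫) + t * (lam * ‖y - x‖ ^ 2) := by
      intro t ht ht1
      have hmem : f ((1 - t) • x + t • y) ≤ (((1 - t) * a + t * r : ℝ) : EReal) := by
        refine (hconv x y (1 - t) t (by linarith) ht.le (by ring)).trans ?_
        push_cast
        have h0 : (0 : EReal) ≤ ((1 - t : ℝ) : EReal) := by
          rw [EReal.coe_nonneg]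
          linarith
        have h1 : (0 : EReal) ≤ (t : EReal) := by
          rw [EReal.coe_nonneg]
          exact ht.le
        have := add_le_add (mul_le_mul_of_nonneg_left hxa h0) (mul_le_mul_of_nonneg_left hyr h1)
        simpa using this
      have h := hmin _ _ hmem
      have hx : (1 - t) • x + t • y - x₀ = (x - x₀) + t • (y - x) := by module
      have hp : (1 - t) • x + t • y = x + t • (y - x) := by module
      rw [hx, norm_add_sq_real, hp, inner_add_right, norm_smul, real_inner_smul_right,
        real_inner_smul_right, Real.norm_of_nonneg ht.le] at h
      rw [inner_sub_left, real_inner_smul_left]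
      refine nonneg_of_mul_nonneg_right ?_ ht
      linarith
    have hlim : Tendsto (fun t : ℝ => (r - a - ⟪p - (2 * lam) • (x - x₀), y - x⟫) +
        t * (lam * ‖y - x‖ ^ 2)) (𝓝[>] 0)
        (𝓝 (r - a - ⟪p - (2 * lam) • (x - x₀), y - x⟫)) := by
      have h : Continuous (fun t : ℝ => (r - a - ⟪p - (2 * lam) • (x - x₀), y - x⟫) +
        t * (lam * ‖y - x‖ ^ 2)) := by fun_prop
      simpa using (h.tendsto 0).mono_left nhdsWithin_le_nhds
    have h0 := ge_of_tendsto hlim (by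
      filter_upwards [Ioc_mem_nhdsGT (zero_lt_one (α := ℝ))] with t ht
      exact hseg t ht.1 ht.2)
    linarith
  · have h1 := hmin x₀ r₀ hr₀
    have h2 := hc x a hxa
    have h3 : lam * ‖x - x₀‖ ^ 2 ≤ C := by
      simp only [sub_self, norm_zero] at h1
      norm_num at h1
      linarith
    rw [dist_eq_norm, sub_sub_cancel, norm_smul, Real.norm_of_nonneg (by positivity)]
    refine lt_of_pow_lt_pow_left₀ 2 hε.le ?_
    nlinarith

/-- A quantitative form of the convexity of the closure of the range of the subdifferential. -/
lemma norm_sub_sq_le_of_minimal {f : H → EReal} (hproper : ∃ y, f y ≠ ⊤)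
    (hnobot : ∀ y, f y ≠ ⊥) (hlsc : LowerSemicontinuous f) (hconv : ConvexE f) {pf : H}
    (hpf : pf ∈ closure (⋃ y, SubdiffE f y) ∧ ∀ q ∈ closure (⋃ y, SubdiffE f y), ‖pf‖ ≤ ‖q‖)
    {p : H} (hp : p ∈ ⋃ y, SubdiffE f y) : ‖p - pf‖ ^ 2 ≤ 2 * (‖p‖ ^ 2 - ‖pf‖ ^ 2) := by
  have hrange : ∀ q ∈ ⋃ y, SubdiffE f y,
      ‖p - q‖ ^ 2 ≤ 2 * ‖p‖ ^ 2 + 2 * ‖q‖ ^ 2 - 4 * ‖pf‖ ^ 2 := by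
    intro q hq
    obtain ⟨x, hx⟩ := mem_iUnion.1 hp
    obtain ⟨y, hy⟩ := mem_iUnion.1 hq
    obtain ⟨a, ha⟩ := exists_coe_eq_of_mem_SubdiffE hproper hnobot hx
    obtain ⟨b, hb⟩ := exists_coe_eq_of_mem_SubdiffE hproper hnobot hy
    have hmid : (1 / 2 : ℝ) • (p + q) ∈ closure (⋃ y, SubdiffE f y) := by
      refine mem_closure_iUnion_SubdiffE hproper hnobot hlsc hconv
        (c := (a - ⟪p, x⟫ + (b - ⟪q, y⟫)) / 2) fun w r hr => ?_
      have h1 := add_inner_le_of_mem_SubdiffE hx ha hr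
      have h2 := add_inner_le_of_mem_SubdiffE hy hb hr
      rw [inner_sub_right] at h1 h2
      rw [real_inner_smul_left, inner_add_left]
      linarith
    have h := hpf.2 _ hmid
    rw [norm_smul, Real.norm_of_nonneg (by norm_num)] at h
    have hpar := parallelogram_law_with_norm ℝ p q
    nlinarith [norm_nonneg pf, norm_nonneg (p + q)]
  have hclosed : IsClosed {q : H | ‖p - q‖ ^ 2 ≤ 2 * ‖p‖ ^ 2 + 2 * ‖q‖ ^ 2 - 4 * ‖pf‖ ^ 2} :=
    isClosed_le (by fun_prop) (by fun_prop)
  have hcl : ‖p - pf‖ ^ 2 ≤ 2 * ‖p‖ ^ 2 + 2 * ‖pf‖ ^ 2 - 4 * ‖pf‖ ^ 2 :=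
    closure_minimal hrange hclosed hpf.1
  linarith

lemma tendsto_minNormElt_of_eventually_norm_le {f : H → EReal} (hproper : ∃ y, f y ≠ ⊤)
    (hnobot : ∀ y, f y ≠ ⊥) (hlsc : LowerSemicontinuous f) (hconv : ConvexE f) {pf : H}
    (hpf : pf ∈ closure (⋃ y, SubdiffE f y) ∧ ∀ q ∈ closure (⋃ y, SubdiffE f y), ‖pf‖ ≤ ‖q‖)
    {ι : Type*} {l : Filter ι} {z : ι → H}
    (h : ∀ ε > 0, ∀ᶠ i in l, ∃ p ∈ SubdiffE f (z i), ‖p‖ ≤ ‖pf‖ + ε) :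
    Tendsto (fun i => minNormElt (SubdiffE f (z i))) l (𝓝 pf) := by
  rw [Metric.tendsto_nhds]
  intro η hη
  have hlim : Tendsto (fun ε : ℝ => 2 * ((‖pf‖ + ε) ^ 2 - ‖pf‖ ^ 2)) (𝓝[>] 0) (𝓝 0) := by
    have hc : Continuous fun ε : ℝ => 2 * ((‖pf‖ + ε) ^ 2 - ‖pf‖ ^ 2) := by fun_prop
    simpa using (hc.tendsto 0).mono_left nhdsWithin_le_nhds
  obtain ⟨ε, hε, hε0⟩ := ((hlim.eventually_lt_const (pow_pos hη 2)).and
    self_mem_nhdsWithin).exists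
  filter_upwards [h ε hε0] with i ⟨p, hp, hpε⟩
  obtain ⟨hmem, hmin⟩ := minNormElt_SubdiffE_spec ⟨p, hp⟩
  have h1 := norm_sub_sq_le_of_minimal hproper hnobot hlsc hconv hpf (mem_iUnion.2 ⟨z i, hmem⟩)
  have h2 := (hmin p hp).trans hpε
  rw [dist_eq_norm]
  refine lt_of_pow_lt_pow_left₀ 2 hη.le (h1.trans_lt (lt_of_le_of_lt ?_ hε))
  gcongr

omit [CompleteSpace H] in
lemma eventually_exists_norm_le_of_tendsto_slopeE {f : H → EReal} {pf : H}
    (hpf : pf ∈ closure (⋃ y, SubdiffE f y)) {ι : Type*} {l : Filter ι} {z : ι → H}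
    (h : Tendsto (fun i => slopeE f (z i)) l (𝓝 (⨅ y, slopeE f y))) {ε : ℝ} (hε : 0 < ε) :
    ∀ᶠ i in l, ∃ p ∈ SubdiffE f (z i), ‖p‖ ≤ ‖pf‖ + ε := by
  obtain ⟨q, hq, hqε⟩ := Metric.mem_closure_iff.1 hpf ε hε
  obtain ⟨y, hy⟩ := mem_iUnion.1 hq
  have hqn : ‖q‖ < ‖pf‖ + ε := by
    have := norm_le_norm_add_norm_sub pf q
    rw [← dist_eq_norm] at this
    linarith
  have hlt : ⨅ y, slopeE f y < ENNReal.ofReal (‖pf‖ + ε) := by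
    refine ((iInf_le _ y).trans (iInf₂_le q hy)).trans_lt ?_
    rw [← enorm_eq_nnnorm, ← ofReal_norm]
    exact (ENNReal.ofReal_lt_ofReal_iff (by positivity)).2 hqn
  filter_upwards [h.eventually_lt_const hlt] with i hi
  simp only [slopeE, iInf_lt_iff] at hi
  obtain ⟨p, hp, hlt⟩ := hi
  rw [← enorm_eq_nnnorm, ← ofReal_norm] at hlt
  exact ⟨p, hp, ((ENNReal.ofReal_lt_ofReal_iff (by positivity)).1 hlt).le⟩

/-! ### Subgradient curves -/

section Curve

variable {f : H → EReal} {γ v : ℝ → H}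

/-- The times at which the curve `γ` has derivative `v` and satisfies the subgradient inclusion. -/
def regularTimes (f : H → EReal) (γ v : ℝ → H) : Set ℝ :=
  {t | 0 < t ∧ HasDerivAt γ (v t) t ∧ -v t ∈ SubdiffE f (γ t)}

omit [InnerProductSpace ℝ H] [CompleteSpace H] in
lemma intervalIntegrable_of_integrableOn_Ioc (hv : ∀ t > 0, IntegrableOn v (Ioc 0 t)) {a b : ℝ}
    (ha : 0 ≤ a) (hb : 0 ≤ b) : IntervalIntegrable v volume a b := by
  have h : ∀ t, 0 ≤ t → IntervalIntegrable v volume 0 t := fun t ht => by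
    rcases ht.eq_or_lt with rfl | ht
    · exact IntervalIntegrable.refl
    · exact (intervalIntegrable_iff_integrableOn_Ioc_of_le ht.le).2 (hv t ht)
  exact (h a ha).symm.trans (h b hb)

omit [CompleteSpace H] in
lemma sub_eq_intervalIntegral (hv : ∀ t > 0, IntegrableOn v (Ioc 0 t)) {x : H}
    (hγ : ∀ t ≥ 0, γ t = x + ∫ s in Ioc 0 t, v s) {a b : ℝ} (ha : 0 ≤ a) (hb : 0 ≤ b) :
    γ b - γ a = ∫ s in a..b, v s := by
  have h := intervalIntegral.integral_interval_sub_left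
    (intervalIntegrable_of_integrableOn_Ioc hv le_rfl hb)
    (intervalIntegrable_of_integrableOn_Ioc hv le_rfl ha)
  rw [← h, hγ a ha, hγ b hb, intervalIntegral.integral_of_le ha, intervalIntegral.integral_of_le hb]
  abel

lemma ae_mem_regularTimes (hv : ∀ t > 0, IntegrableOn v (Ioc 0 t)) {x : H}
    (hγ : ∀ t ≥ 0, γ t = x + ∫ s in Ioc 0 t, v s)
    (hsub : ∀ᵐ t ∂(volume.restrict (Ioi (0 : ℝ))), -v t ∈ SubdiffE f (γ t)) :
    ∀ᵐ t, 0 < t → t ∈ regularTimes f γ v := by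
  have h1 := (ae_restrict_iff' measurableSet_Ioi).1 hsub
  have h2 : ∀ᵐ t, ∀ n : ℕ, t ∈ uIcc (0 : ℝ) n → ∀ c ∈ uIcc (0 : ℝ) n,
      HasDerivAt (fun x => ∫ s in c..x, v s) (v t) t :=
    ae_all_iff.2 fun n => (intervalIntegrable_of_integrableOn_Ioc hv le_rfl
      n.cast_nonneg).ae_hasDerivAt_integral
  filter_upwards [h1, h2] with t h1 h2 ht
  refine ⟨ht, ?_, h1 ht⟩
  obtain ⟨n, hn⟩ := exists_nat_ge t
  have hd := h2 n (by rw [uIcc_of_le n.cast_nonneg]; exact ⟨ht.le, hn⟩) 0 left_mem_uIcc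
  refine (hd.const_add x).congr_of_eventuallyEq ?_
  filter_upwards [Ioi_mem_nhds ht] with s hs
  rw [hγ s hs.le, intervalIntegral.integral_of_le hs.le]

omit [CompleteSpace H] in
lemma nhdsWithin_Ioo_inter_regularTimes_neBot (hreg : ∀ᵐ t, 0 < t → t ∈ regularTimes f γ v)
    {a t : ℝ} (ha : 0 ≤ a) (hat : a < t) : (𝓝[Ioo a t ∩ regularTimes f γ v] t).NeBot := by
  rw [← mem_closure_iff_nhdsWithin_neBot]
  have hd := Measure.dense_of_ae hreg
  have h1 : t ∈ closure (Ioo a t) := by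
    rw [closure_Ioo hat.ne]
    exact right_mem_Icc.2 hat.le
  have h2 := closure_mono (hd.open_subset_closure_inter (isOpen_Ioo (a := a) (b := t))) h1
  rw [closure_closure] at h2
  refine closure_mono ?_ h2
  exact fun s hs => ⟨hs.1, hs.2 (ha.trans_lt hs.1.1)⟩

omit [CompleteSpace H] in
/-- The distance between a subgradient curve and its translates in time is nonincreasing. -/
lemma norm_translate_sub_le (hproper : ∃ y, f y ≠ ⊤) (hnobot : ∀ y, f y ≠ ⊥)
    (hv : ∀ t > 0, IntegrableOn v (Ioc 0 t)) {x : H}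
    (hγ : ∀ t ≥ 0, γ t = x + ∫ s in Ioc 0 t, v s)
    (hreg : ∀ᵐ t, 0 < t → t ∈ regularTimes f γ v) {a b h : ℝ} (ha : 0 ≤ a) (hab : a ≤ b)
    (hh : 0 ≤ h) : ‖γ (b + h) - γ b‖ ≤ ‖γ (a + h) - γ a‖ := by
  have hpos : ∀ t ∈ uIcc a b, 0 ≤ t := fun t ht => by
    rw [uIcc_of_le hab] at ht
    exact ha.trans ht.1
  have hac : AbsolutelyContinuousOnInterval γ a b :=
    .of_sub_eq_integral (intervalIntegrable_of_integrableOn_Ioc hv ha (ha.trans hab))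
      fun s hs t ht => sub_eq_intervalIntegral hv hγ (hpos s hs) (hpos t ht)
  have hac' : AbsolutelyContinuousOnInterval (fun t => γ (t + h)) a b := by
    refine .of_sub_eq_integral (w := fun t => v (t + h)) ?_ fun s hs t ht => ?_
    · have := (intervalIntegrable_of_integrableOn_Ioc hv (add_nonneg ha hh)
        (add_nonneg (ha.trans hab) hh)).comp_add_right h
      simpa using this
    · rw [sub_eq_intervalIntegral hv hγ (add_nonneg (hpos s hs) hh) (add_nonneg (hpos t ht) hh),
        intervalIntegral.integral_comp_add_right v h]
  have hφ := (hac'.fun_sub hac).norm_sq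
  have hle := hφ.le_of_ae_deriv_nonpos hab ?_
  · exact le_of_sq_le_sq hle (norm_nonneg _)
  have hreg' : ∀ᵐ t, 0 < t + h → t + h ∈ regularTimes f γ v :=
    (measurePreserving_add_right volume h).quasiMeasurePreserving.ae hreg
  have hne : ∀ᵐ t : ℝ, t ≠ 0 := by simp [ae_iff, measure_singleton]
  filter_upwards [hreg, hreg', hne] with t h1 h2 h3 ht
  have ht0 : 0 < t := lt_of_le_of_ne (ha.trans ht.1) h3.symm
  obtain ⟨-, hd1, hs1⟩ := h1 ht0
  obtain ⟨-, hd2, hs2⟩ := h2 (by linarith)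
  refine (HasDerivAt.deriv ((hd2.comp_add_const t h).sub hd1).norm_sq).trans_le ?_
  have := inner_sub_nonneg_of_mem_SubdiffE hproper hnobot hs2 hs1
  rw [show -v (t + h) - -v t = -(v (t + h) - v t) by abel, inner_neg_right] at this
  change 2 * ⟪γ (t + h) - γ t, v (t + h) - v t⟫ ≤ 0
  linarith

omit [CompleteSpace H] in
lemma norm_velocity_antitone (hproper : ∃ y, f y ≠ ⊤) (hnobot : ∀ y, f y ≠ ⊥)
    (hv : ∀ t > 0, IntegrableOn v (Ioc 0 t)) {x : H}
    (hγ : ∀ t ≥ 0, γ t = x + ∫ s in Ioc 0 t, v s)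
    (hreg : ∀ᵐ t, 0 < t → t ∈ regularTimes f γ v) :
    AntitoneOn (fun t => ‖v t‖) (regularTimes f γ v) := by
  intro s hs t ht hst
  refine le_of_tendsto_of_tendsto ht.2.1.tendsto_slope_zero_right.norm
    hs.2.1.tendsto_slope_zero_right.norm ?_
  filter_upwards [self_mem_nhdsWithin] with h hh
  rw [norm_smul, norm_smul]
  gcongr
  exact norm_translate_sub_le hproper hnobot hv hγ hreg hs.1.le hst (le_of_lt hh)

lemma exists_mem_SubdiffE_norm_le_of_regularTimes (hlsc : LowerSemicontinuous f)
    (hcont : ContinuousOn γ (Ici 0)) (hreg : ∀ᵐ t, 0 < t → t ∈ regularTimes f γ v)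
    {a t L : ℝ} (ha : 0 ≤ a) (hat : a < t)
    (hL : ∀ s ∈ regularTimes f γ v, a < s → s < t → ‖v s‖ ≤ L) :
    ∃ p ∈ SubdiffE f (γ t), ‖p‖ ≤ L := by
  have := nhdsWithin_Ioo_inter_regularTimes_neBot hreg ha hat
  have hmem : ∀ᶠ s in 𝓝[Ioo a t ∩ regularTimes f γ v] t, s ∈ Ioo a t ∩ regularTimes f γ v :=
    self_mem_nhdsWithin
  refine exists_mem_SubdiffE_of_tendsto hlsc (l := 𝓝[Ioo a t ∩ regularTimes f γ v] t)
    (z := γ) (p := fun s => -v s) ?_ ?_ ?_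
  · exact ((hcont t (ha.trans hat.le)).tendsto).mono_left
      (nhdsWithin_mono _ fun s hs => ha.trans hs.1.1.le)
  · filter_upwards [hmem] with s hs using hs.2.2.2
  · filter_upwards [hmem] with s hs
    rw [norm_neg]
    exact hL s hs.2 hs.1.1 hs.1.2

omit [CompleteSpace H] in
/-- Along a curve with bounded subgradients, the derivative of `f ∘ γ` is `-‖γ'‖ ^ 2`. -/
lemma deriv_eq_neg_norm_sq_of_mem_regularTimes {F : ℝ → ℝ} {t δ : ℝ} (hδ : δ < t)
    (hF : ∀ s ≥ δ, f (γ s) = F s) (ht : t ∈ regularTimes f γ v) (hd : DifferentiableAt ℝ F t) :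
    deriv F t = -‖v t‖ ^ 2 := by
  have hmin : IsLocalMin (fun s => F s + ⟪v t, γ s⟫) t := by
    filter_upwards [Ioi_mem_nhds hδ] with s hs
    have h := add_inner_le_of_mem_SubdiffE ht.2.2 (hF t hδ.le) (hF s (le_of_lt hs)).le
    rw [inner_neg_left, inner_sub_right] at h
    linarith
  have h := hmin.hasDerivAt_eq_zero
    (hd.hasDerivAt.add ((hasDerivAt_const t (v t)).inner ℝ ht.2.1))
  rw [inner_zero_left, add_zero, real_inner_self_eq_norm_sq] at h
  linarith

/-- The decay estimate for the speed of a subgradient curve, in terms of any subgradient. -/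
lemma norm_velocity_le (hproper : ∃ y, f y ≠ ⊤) (hnobot : ∀ y, f y ≠ ⊥)
    (hlsc : LowerSemicontinuous f) (hcont : ContinuousOn γ (Ici 0))
    (hv : ∀ t > 0, IntegrableOn v (Ioc 0 t)) {x : H}
    (hγ : ∀ t ≥ 0, γ t = x + ∫ s in Ioc 0 t, v s)
    (hreg : ∀ᵐ t, 0 < t → t ∈ regularTimes f γ v) {δ T : ℝ} (hδ : δ ∈ regularTimes f γ v)
    (hT : T ∈ regularTimes f γ v) (hδT : δ < T) {y q : H} (hq : q ∈ SubdiffE f y) :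
    (T - δ) * ‖v T‖ ≤ (T - δ) * ‖q‖ + ‖γ δ - y‖ := by
  have hanti := norm_velocity_antitone hproper hnobot hv hγ hreg
  set L := ‖v δ‖ with hL
  have hsub : ∀ t, δ ≤ t → ∃ p ∈ SubdiffE f (γ t), ‖p‖ ≤ L := by
    intro t ht
    rcases ht.eq_or_lt with rfl | ht
    · exact ⟨-v δ, hδ.2.2, (norm_neg _).le⟩
    · exact exists_mem_SubdiffE_norm_le_of_regularTimes hlsc hcont hreg hδ.1.le ht
        fun s hs hs1 _ => hanti hδ hs hs1.le
  have hF : ∀ s ≥ δ, f (γ s) = ((f (γ s)).toReal : EReal) := by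
    intro s hs
    obtain ⟨p, hp, -⟩ := hsub s hs
    obtain ⟨a, ha⟩ := exists_coe_eq_of_mem_SubdiffE hproper hnobot hp
    simp [ha]
  set F : ℝ → ℝ := fun s => (f (γ s)).toReal with hFdef
  have hγlip : ∀ s, δ ≤ s → ∀ t, δ ≤ t → ‖γ t - γ s‖ ≤ L * |t - s| := by
    intro s hs t ht
    rw [sub_eq_intervalIntegral hv hγ (hδ.1.le.trans hs) (hδ.1.le.trans ht)]
    refine intervalIntegral.norm_integral_le_of_norm_le_const_ae ?_
    filter_upwards [hreg] with u hu hmem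
    have hu' : δ < u := (le_inf hs ht).trans_lt hmem.1
    exact hanti hδ (hu (hδ.1.trans hu')) hu'.le
  have hFlip' : ∀ s, δ ≤ s → ∀ t, δ ≤ t → F t - F s ≤ L * L * |t - s| := by
    intro s hs t ht
    obtain ⟨p, hp, hpL⟩ := hsub t ht
    have h := add_inner_le_of_mem_SubdiffE hp (hF t ht) (hF s hs).le
    have h2 : ⟪p, γ t - γ s⟫ ≤ L * (L * |t - s|) :=
      (real_inner_le_norm _ _).trans (mul_le_mul hpL (hγlip s hs t ht) (norm_nonneg _)
        (norm_nonneg _))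
    rw [← neg_sub (γ t), inner_neg_right] at h
    linarith
  have hmem : ∀ t ∈ uIcc δ T, δ ≤ t := fun t ht => by
    rw [uIcc_of_le hδT.le] at ht
    exact ht.1
  have hFac : AbsolutelyContinuousOnInterval F δ T := by
    refine LipschitzOnWith.absolutelyContinuousOnInterval (K := Real.toNNReal (L * L))
      (LipschitzOnWith.of_dist_le_mul fun s hs t ht => ?_)
    rw [Real.dist_eq, Real.dist_eq, Real.coe_toNNReal _ (by positivity), abs_le']
    refine ⟨hFlip' t (hmem t ht) s (hmem s hs), ?_⟩
    rw [neg_sub, abs_sub_comm]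
    exact hFlip' s (hmem s hs) t (hmem t ht)
  have hγac : AbsolutelyContinuousOnInterval γ δ T :=
    .of_sub_eq_integral (intervalIntegrable_of_integrableOn_Ioc hv hδ.1.le hT.1.le)
      fun s hs t ht => sub_eq_intervalIntegral hv hγ (hδ.1.le.trans (hmem s hs))
        (hδ.1.le.trans (hmem t ht))
  have hsmooth : ∀ g : ℝ → ℝ, ContDiff ℝ 1 g → AbsolutelyContinuousOnInterval g δ T :=
    fun g hg => hg.contDiffOn.absolutelyContinuousOnInterval
  obtain ⟨b, hb⟩ := exists_coe_eq_of_mem_SubdiffE hproper hnobot hq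
  set c := ‖v T‖ ^ 2 with hc
  have hΦac : AbsolutelyContinuousOnInterval
      (fun t => (t - δ) * (F t - b) + 1 / 2 * ‖γ t - y‖ ^ 2 + c / 2 * (t - δ) ^ 2) δ T := by
    refine (((hsmooth _ (by fun_prop)).fun_mul (hFac.fun_sub (hsmooth _ (by fun_prop)))).fun_add
      ((hsmooth _ (by fun_prop)).fun_mul ?_)).fun_add (hsmooth _ (by fun_prop))
    refine (hγac.of_dist_le (g := fun t => γ t - y) fun s _ t _ => ?_).norm_sq
    simp
  have hle := hΦac.le_of_ae_deriv_nonpos hδT.le ?_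
  · have h1 := add_inner_le_of_mem_SubdiffE hq hb (hF T hδT.le).le
    have h2 : 0 ≤ ‖(γ T - y) + (T - δ) • q‖ ^ 2 := by positivity
    have hτ : 0 < T - δ := sub_pos.2 hδT
    rw [norm_add_sq_real, norm_smul, real_inner_smul_right, Real.norm_of_nonneg hτ.le,
      real_inner_comm] at h2
    have h3 : (T - δ) * ⟪q, γ T - y⟫ ≤ (T - δ) * (F T - b) :=
      mul_le_mul_of_nonneg_left (by linarith) hτ.le
    simp only [sub_self, zero_mul, zero_add] at hle
    refine le_of_sq_le_sq ?_ (by positivity)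
    have h4 : 0 ≤ (T - δ) * ‖q‖ * ‖γ δ - y‖ := by positivity
    rw [hc] at hle
    nlinarith
  have hne : ∀ᵐ t : ℝ, t ≠ δ := by simp [ae_iff, measure_singleton]
  filter_upwards [hreg, hFac.ae_differentiableAt, hne] with t ht hFd htδ htm
  have htδ' : δ < t := lt_of_le_of_ne htm.1 htδ.symm
  have htreg := ht (hδ.1.trans htδ')
  have hFd' := hFd (by rwa [uIcc_of_le hδT.le])
  have hFderiv := deriv_eq_neg_norm_sq_of_mem_regularTimes htδ' hF htreg hFd'
  have hid : HasDerivAt (fun s => s - δ) 1 t := (hasDerivAt_id t).sub_const δ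
  have hΦ := ((hid.mul (hFd'.hasDerivAt.sub_const b)).add
    ((htreg.2.1.sub_const y).norm_sq.const_mul (1 / 2))).add ((hid.pow 2).const_mul (c / 2))
  refine (HasDerivAt.deriv hΦ).trans_le ?_
  have h1 := add_inner_le_of_mem_SubdiffE htreg.2.2 (hF t htδ'.le) hb.le
  rw [← neg_sub (γ t), inner_neg_neg, real_inner_comm] at h1
  have h2 : c ≤ ‖v t‖ ^ 2 :=
     pow_le_pow_left₀ (norm_nonneg _) (hanti htreg hT htm.2) 2
  have h3 : (t - δ) * c ≤ (t - δ) * ‖v t‖ ^ 2 :=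
    mul_le_mul_of_nonneg_left h2 (sub_nonneg.2 htδ'.le)
  rw [hFderiv]
  norm_num
  linarith

lemma eventually_exists_norm_le_of_isSubgradientCurve (hproper : ∃ y, f y ≠ ⊤)
    (hnobot : ∀ y, f y ≠ ⊥) (hlsc : LowerSemicontinuous f) {pf : H}
    (hpf : pf ∈ closure (⋃ y, SubdiffE f y)) {x : H} (hcurve : IsSubgradientCurve f x γ) {ε : ℝ}
    (hε : 0 < ε) : ∀ᶠ t in atTop, ∃ p ∈ SubdiffE f (γ t), ‖p‖ ≤ ‖pf‖ + ε := by
  obtain ⟨-, hcont, v, hv, hγ, hsub⟩ := hcurve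
  have hreg := ae_mem_regularTimes hv hγ hsub
  have := nhdsWithin_Ioo_inter_regularTimes_neBot hreg le_rfl one_pos
  obtain ⟨δ, -, hδ⟩ := this.nonempty_of_mem self_mem_nhdsWithin
  obtain ⟨q, hq, hqε⟩ := Metric.mem_closure_iff.1 hpf (ε / 2) (by positivity)
  obtain ⟨y, hy⟩ := mem_iUnion.1 hq
  have hqn : ‖q‖ ≤ ‖pf‖ + ε / 2 := by
    have := norm_le_norm_add_norm_sub pf q
    rw [← dist_eq_norm] at this
    linarith
  set d := ‖γ δ - y‖
  filter_upwards [eventually_gt_atTop (δ + 2 * d / ε)] with t ht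
  have hd : 0 ≤ 2 * d / ε := by positivity
  refine exists_mem_SubdiffE_norm_le_of_regularTimes hlsc hcont hreg
    (add_nonneg hδ.1.le hd) ht fun s hs hs1 _ => ?_
  have hτ : 2 * d / ε < s - δ := by linarith
  have h := norm_velocity_le hproper hnobot hlsc hcont hv hγ hreg hδ hs (by linarith) hy
  rw [div_lt_iff₀ hε] at hτ
  have hpos : 0 < s - δ := by linarith
  refine le_of_mul_le_mul_left (h.trans ?_) hpos
  nlinarith

end Curve

/-- **Convergence of minimal-norm subgradients to the Crandall–Pazy direction.**
Let `f` be proper lsc convex and let `pf` be the Crandall–Pazy direction of `f`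
(the element of minimal norm of the closure of the range of the subdifferential).
If `(x n)` is a sequence in `dom ∂f` with slopes converging to `inf_H s_f`, then
`∂°f(x n) → pf` strongly. In particular `∂°f(γ t) → pf` along every subgradient curve. -/
theorem minNorm_subgradient_tendsto_CrandallPazy
    (f : H → EReal)
    (hproper : ∃ y, f y ≠ ⊤) (hnobot : ∀ y, f y ≠ ⊥)
    (hlsc : LowerSemicontinuous f) (hconv : ConvexE f)
    (pf : H)
    (hpf : pf ∈ closure (⋃ y, SubdiffE f y) ∧
      ∀ q ∈ closure (⋃ y, SubdiffE f y), ‖pf‖ ≤ ‖q‖) :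
    (∀ x : ℕ → H, (∀ n, (SubdiffE f (x n)).Nonempty) →
      Filter.Tendsto (fun n => slopeE f (x n)) Filter.atTop (nhds (⨅ y, slopeE f y)) →
      Filter.Tendsto (fun n => minNormElt (SubdiffE f (x n))) Filter.atTop (nhds pf)) ∧
    (∀ (x : H) (γ : ℝ → H), x ∈ closure {y | f y ≠ ⊤} → IsSubgradientCurve f x γ →
      Filter.Tendsto (fun t => minNormElt (SubdiffE f (γ t))) Filter.atTop (nhds pf)) := by
  have hkey {ι : Type} {l : Filter ι} {z : ι → H}
      (h : ∀ ε > 0, ∀ᶠ i in l, ∃ p ∈ SubdiffE f (z i), ‖p‖ ≤ ‖pf‖ + ε) :=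
    tendsto_minNormElt_of_eventually_norm_le hproper hnobot hlsc hconv hpf h
  exact ⟨fun x _ hx => hkey fun ε hε => eventually_exists_norm_le_of_tendsto_slopeE hpf.1 hx hε,
    fun x γ _ hγ => hkey fun ε hε =>
      eventually_exists_norm_le_of_isSubgradientCurve hproper hnobot hlsc hpf.1 hγ hε⟩
end
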